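/- Let T be a tile system in an arbitrary neighborhood N, with finite set of glues X. There exist a finite glue set X_μ, a tile system T_μ in neighborhood N_vN over X_μ, a scale s ≥ 1, a polyomino assignment φ, and a tiling-simulation ψ of T by T_μ such that for every (T,N)-tiling τ: τ is finite if and only if every poly-tiling in ψ(τ), viewed as a (T_μ,N_vN)-tiling via its induced tiling, is finite. -/

import Mathlib

namespace Paper

open scoped Classical

abbrev Pos : Type := ℤ × ℤ

/-- The von Neumann neighborhood. -/
def Nvn : Set Pos := {(0, 1), (1, 0), (0, -1), (-1, 0)}

/-- A neighborhood: a finite symmetric set of positions not containing the origin. -/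
def IsNeighborhood (N : Set Pos) : Prop :=
  N.Finite ∧ (0, 0) ∉ N ∧ ∀ w ∈ N, -w ∈ N

/-- A tile over glues `X` and neighborhood `N` : a function from `N` to `X`. -/
abbrev Tile (X : Type) (N : Set Pos) : Type := {w : Pos // w ∈ N} → X

/-- Scaling a position by an integer. -/
def sc (s : ℤ) (u : Pos) : Pos := (s * u.1, s * u.2)

/-- Domain of a partial map on the plane. -/
def tdom {α : Type} (τ : Pos → Option α) : Set Pos := {p | τ p ≠ none}

/-- A (T,N)-tiling: a partial map to tiles of `T` such that all neighboring glues match. -/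
def IsTiling {X : Type} {N : Set Pos} (T : Set (Tile X N))
    (τ : Pos → Option (Tile X N)) : Prop :=
  (∀ p t, τ p = some t → t ∈ T) ∧
  (∀ p t, τ p = some t → ∀ w t', τ (p + w) = some t' →
    ∀ (hw : w ∈ N) (hw' : -w ∈ N), t ⟨w, hw⟩ = t' ⟨-w, hw'⟩)

def IsFiniteTiling {X : Type} {N : Set Pos} (T : Set (Tile X N))
    (τ : Pos → Option (Tile X N)) : Prop :=
  IsTiling T τ ∧ (tdom τ).Finite

/-- A partial map on the plane is total if it is defined everywhere. -/
def TotalDom {α : Type} (τ : Pos → Option α) : Prop := ∀ p, τ p ≠ none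

/-- A poly-tiling of scale `s`: a partial map from grid positions to finite tilings,
satisfying (i) each component is a finite tiling, (ii) translated domains are disjoint,
(iii) neighboring (after translation) tiles of two components have matching glues. -/
def IsPolyTiling {X : Type} {N : Set Pos} (T : Set (Tile X N)) (s : ℤ)
    (σ : Pos → Option (Pos → Option (Tile X N))) : Prop :=
  (∀ u τu, σ u = some τu → IsFiniteTiling T τu) ∧
  (∀ u v τu τv, u ≠ v → σ u = some τu → σ v = some τv →
    ∀ p, τu p ≠ none → ∀ q, τv q ≠ none → sc s u + p ≠ sc s v + q) ∧
  (∀ u u' τu τu', σ u = some τu → σ u' = some τu' →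
    ∀ v t, τu v = some t → ∀ v' t', τu' v' = some t' →
    ∀ (hw : (sc s u' + v') - (sc s u + v) ∈ N)
      (hw' : -((sc s u' + v') - (sc s u + v)) ∈ N),
      t ⟨(sc s u' + v') - (sc s u + v), hw⟩ =
        t' ⟨-((sc s u' + v') - (sc s u + v)), hw'⟩)

/-- The tiling induced by a poly-tiling: position `s•u + v` carries the tile `σ u v`. -/
noncomputable def induced {α : Type} (s : ℤ) (σ : Pos → Option (Pos → Option α)) :
    Pos → Option α := fun p =>
  if h : ∃ t, ∃ u τu v, σ u = some τu ∧ τu v = some t ∧ p = sc s u + v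
    then some h.choose else none

/-- Periodicity of a (partial) tiling, with horizontal and vertical periods. -/
def PeriodicT {α : Type} (τ : Pos → Option α) : Prop :=
  ∃ ph pv : ℤ, 0 < ph ∧ 0 < pv ∧
    ∀ (p : Pos) (a b : ℤ), τ p ≠ none →
      τ (p.1 + a * ph, p.2 + b * pv) ≠ none →
      τ p = τ (p.1 + a * ph, p.2 + b * pv)

def LineConvex {α : Type} (τ : Pos → Option α) : Prop :=
  ∀ x₁ x₂ x y : ℤ, τ (x₁, y) ≠ none → τ (x₂, y) ≠ none →
    x₁ < x → x < x₂ → τ (x, y) ≠ none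

def ColumnConvex {α : Type} (τ : Pos → Option α) : Prop :=
  ∀ x y₁ y₂ y : ℤ, τ (x, y₁) ≠ none → τ (x, y₂) ≠ none →
    y₁ < y → y < y₂ → τ (x, y) ≠ none

/-- 4-connectedness of a set of positions. -/
def ConnectedDom (D : Set Pos) : Prop :=
  ∀ p ∈ D, ∀ q ∈ D, ∃ (n : ℕ) (c : ℕ → Pos), c 0 = p ∧ c n = q ∧
    (∀ k ≤ n, c k ∈ D) ∧ ∀ k < n, c (k + 1) - c k ∈ Nvn

/-- The connected linear neighborhood `N_n`. -/
def Nlin (n : ℤ) : Set Pos := {w | w.2 = 0 ∧ 0 < |w.1| ∧ |w.1| ≤ n}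

/-- The rectangular neighborhood `N_{m,n}`. -/
def Nrect (m n : ℤ) : Set Pos := {w | |w.1| ≤ m ∧ |w.2| ≤ n ∧ w ≠ (0, 0)}

/-- A set of consecutive integers. -/
def IsInterval (I : Set ℤ) : Prop :=
  ∀ a b c : ℤ, a ∈ I → c ∈ I → a ≤ b → b ≤ c → b ∈ I

/-- A path: a map from a set of consecutive integers to the plane, consecutive
positions being (von Neumann) adjacent. -/
def IsPath (I : Set ℤ) (P : ℤ → Pos) : Prop :=
  IsInterval I ∧ ∀ i : ℤ, i ∈ I → i + 1 ∈ I → P (i + 1) - P i ∈ Nvn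

/-- A T-tiled path: a path together with a map from its range to tiles of `T`. -/
def IsTiledPath {X : Type} {N : Set Pos} (T : Set (Tile X N)) (I : Set ℤ)
    (P : ℤ → Pos) (r : Pos → Option (Tile X N)) : Prop :=
  IsPath I P ∧ tdom r = P '' I ∧ ∀ p t, r p = some t → t ∈ T

/-- A T-ribbon: an injective tiled path in which consecutive tiles stick. -/
def IsRibbon {X : Type} (T : Set (Tile X Nvn)) (I : Set ℤ) (P : ℤ → Pos)
    (r : Pos → Option (Tile X Nvn)) : Prop :=
  IsTiledPath T I P r ∧ (∀ i ∈ I, ∀ j ∈ I, P i = P j → i = j) ∧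
  (∀ i : ℤ, i ∈ I → i + 1 ∈ I → ∀ t t', r (P i) = some t → r (P (i + 1)) = some t' →
    ∀ (hv : P (i + 1) - P i ∈ Nvn) (hv' : -(P (i + 1) - P i) ∈ Nvn),
      t ⟨P (i + 1) - P i, hv⟩ = t' ⟨-(P (i + 1) - P i), hv'⟩)

/-- A (T,N)-zipper: an injective tiled path whose tile map is a (T,N)-tiling. -/
def IsZipper {X : Type} {N : Set Pos} (T : Set (Tile X N)) (I : Set ℤ)
    (P : ℤ → Pos) (r : Pos → Option (Tile X N)) : Prop :=
  IsTiledPath T I P r ∧ (∀ i ∈ I, ∀ j ∈ I, P i = P j → i = j) ∧ IsTiling T r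

/-- Bundled T-ribbons (tile system in the von Neumann neighborhood). -/
structure Ribbon (X : Type) (T : Set (Tile X Nvn)) : Type where
  I : Set ℤ
  P : ℤ → Pos
  r : Pos → Option (Tile X Nvn)
  isRibbon : IsRibbon T I P r

/-- A poly-ribbon of scale `s` with macro path `(J, Q)` and components `ρ`. -/
def IsPolyRibbon {X : Type} {T : Set (Tile X Nvn)} (s : ℤ) (J : Set ℤ)
    (Q : ℤ → Pos) (ρ : Pos → Option (Ribbon X T)) : Prop :=
  IsPath J Q ∧ (∀ i ∈ J, ∀ j ∈ J, Q i = Q j → i = j) ∧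
  tdom ρ = Q '' J ∧
  (∀ u R, ρ u = some R → R.I.Finite ∧ R.I.Nonempty) ∧
  (∀ u v R S, u ≠ v → ρ u = some R → ρ v = some S →
    ∀ p, R.r p ≠ none → ∀ q, S.r q ≠ none → sc s u + p ≠ sc s v + q) ∧
  (∀ j : ℤ, j ∈ J → j + 1 ∈ J → ∀ R₁ R₂, ρ (Q j) = some R₁ → ρ (Q (j + 1)) = some R₂ →
    ∀ m₁, IsGreatest R₁.I m₁ → ∀ m₂, IsLeast R₂.I m₂ →
      ((sc s (Q (j + 1)) + R₂.P m₂) - (sc s (Q j) + R₁.P m₁) ∈ Nvn ∧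
      ∀ t₁ t₂, R₁.r (R₁.P m₁) = some t₁ → R₂.r (R₂.P m₂) = some t₂ →
        ∀ (hv : (sc s (Q (j + 1)) + R₂.P m₂) - (sc s (Q j) + R₁.P m₁) ∈ Nvn)
          (hv' : -((sc s (Q (j + 1)) + R₂.P m₂) - (sc s (Q j) + R₁.P m₁)) ∈ Nvn),
          t₁ ⟨(sc s (Q (j + 1)) + R₂.P m₂) - (sc s (Q j) + R₁.P m₁), hv⟩ =
            t₂ ⟨-((sc s (Q (j + 1)) + R₂.P m₂) - (sc s (Q j) + R₁.P m₁)), hv'⟩))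

/-- A zipper-simulation of `T` (in neighborhood `N`) by `Tμ` (in the von Neumann
neighborhood), of scale `s`, consisting of a polyomino assignment `phi`, the
trimming map `chi` and the simulation map `psi`. -/
structure ZipperSimulation (X Xμ : Type) (N : Set Pos) (T : Set (Tile X N))
    (Tμ : Set (Tile Xμ Nvn)) (s : ℤ) : Type where
  hs : 1 ≤ s
  phi : Tile X N → Set (Ribbon Xμ Tμ)
  phi_fin : ∀ t, ∀ R ∈ phi t, R.I.Finite ∧ R.I.Nonempty
  phi_ref : ∀ t, ∀ R ∈ phi t, R.r (0, 0) ≠ none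
  phi_spec : ∀ t t', t ≠ t' → ∀ R ∈ phi t, ∀ S ∈ phi t',
    ∀ p q a b, R.r p = some a → S.r q = some b → a ≠ b
  chi : Ribbon Xμ Tμ → Pos → Option (Ribbon Xμ Tμ)
  chi_poly : ∀ R : Ribbon Xμ Tμ, ∃ J Q, IsPolyRibbon s J Q (chi R)
  chi_sub : ∀ R u S, chi R u = some S →
    (∃ t ∈ T, S ∈ phi t) ∧ ∀ p a, S.r p = some a → R.r (sc s u + p) = some a
  chi_max : ∀ (R : Ribbon Xμ Tμ) (t : Tile X N), t ∈ T → ∀ S ∈ phi t, ∀ u : Pos,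
    (∀ p a, S.r p = some a → R.r (sc s u + p) = some a) → chi R u ≠ none
  psi : Set ℤ → (ℤ → Pos) → (Pos → Option (Tile X N)) → Set (Pos → Option (Ribbon Xμ Tμ))
  psi_nonempty : ∀ I P r, IsZipper T I P r → (psi I P r).Nonempty
  psi_poly : ∀ I P r, IsZipper T I P r → ∀ ρ ∈ psi I P r, IsPolyRibbon s I P ρ
  psi_comp : ∀ I P r, IsZipper T I P r → ∀ ρ ∈ psi I P r,
    ∀ u t, r u = some t → ∀ S, ρ u = some S → S ∈ phi t
  psi_exists : ∀ R : Ribbon Xμ Tμ, ∃ I P r, IsZipper T I P r ∧ chi R ∈ psi I P r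
  psi_unique : ∀ (R : Ribbon Xμ Tμ) I P r I' P' r',
    IsZipper T I P r → IsZipper T I' P' r' →
    chi R ∈ psi I P r → chi R ∈ psi I' P' r' →
    r = r' ∧ ∃ d : ℤ, (∀ i, i ∈ I ↔ i + d ∈ I') ∧ ∀ i ∈ I, P' (i + d) = P i

/-- A tiling-simulation of `T` (in neighborhood `N`) by `Tμ` (in the von Neumann
neighborhood), of scale `s`, consisting of a polyomino assignment `phi`, the
trimming map `chi` and the simulation map `psi`. -/
structure TilingSimulation (X Xμ : Type) (N : Set Pos) (T : Set (Tile X N))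
    (Tμ : Set (Tile Xμ Nvn)) (s : ℤ) : Type where
  hs : 1 ≤ s
  phi : Tile X N → Set (Pos → Option (Tile Xμ Nvn))
  phi_fin : ∀ t, ∀ τ' ∈ phi t, IsFiniteTiling Tμ τ'
  phi_ref : ∀ t, ∀ τ' ∈ phi t, τ' (0, 0) ≠ none
  phi_spec : ∀ t t', t ≠ t' → ∀ τ₁ ∈ phi t, ∀ τ₂ ∈ phi t',
    ∀ p q a b, τ₁ p = some a → τ₂ q = some b → a ≠ b
  chi : (Pos → Option (Tile Xμ Nvn)) → Pos → Option (Pos → Option (Tile Xμ Nvn))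
  chi_poly : ∀ τ', IsTiling Tμ τ' → IsPolyTiling Tμ s (chi τ')
  chi_sub : ∀ τ' u σu, chi τ' u = some σu →
    (∃ t ∈ T, σu ∈ phi t) ∧ ∀ p a, σu p = some a → τ' (sc s u + p) = some a
  chi_max : ∀ (τ' : Pos → Option (Tile Xμ Nvn)) (t : Tile X N), t ∈ T →
    ∀ σu ∈ phi t, ∀ u : Pos,
    (∀ p a, σu p = some a → τ' (sc s u + p) = some a) → chi τ' u ≠ none
  psi : (Pos → Option (Tile X N)) → Set (Pos → Option (Pos → Option (Tile Xμ Nvn)))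
  psi_nonempty : ∀ τ, IsTiling T τ → (psi τ).Nonempty
  psi_poly : ∀ τ, IsTiling T τ → ∀ σ ∈ psi τ, IsPolyTiling Tμ s σ
  psi_dom : ∀ τ, IsTiling T τ → ∀ σ ∈ psi τ, ∀ u, σ u ≠ none ↔ τ u ≠ none
  psi_comp : ∀ τ, IsTiling T τ → ∀ σ ∈ psi τ,
    ∀ u t, τ u = some t → ∀ σu, σ u = some σu → σu ∈ phi t
  psi_recover : ∀ τ', IsTiling Tμ τ' → ∃! τ, IsTiling T τ ∧ chi τ' ∈ psi τ

/-- The cells of a macro-tile: a reference cell and, for each direction `w` of the simulated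
neighborhood, a cell sending a glue to the macro-tile at offset `w` and a cell receiving the
glue sent by the macro-tile at offset `-w`. -/
inductive Cell (N : Set Pos) : Type
  | ref : Cell N
  | send (w : {w : Pos // w ∈ N}) : Cell N
  | recv (w : {w : Pos // w ∈ N}) : Cell N

namespace Cell

variable {N : Set Pos}

/-- Index of the grid square containing a cell, relative to the macro-tile of the cell. -/
def shift : Cell N → Pos
  | ref => 0
  | send _ => 0
  | recv w => -w.1

/-- Abscissa of a cell inside its grid square. -/
def col : Cell N → ℤ
  | ref => 0
  | send _ => 0
  | recv _ => 1

/-- Half the ordinate of a cell inside its grid square. -/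
def row (k : {w : Pos // w ∈ N} → ℤ) : Cell N → ℤ
  | ref => 0
  | send w => k w
  | recv w => k w

/-- Position of a cell relative to the reference cell. -/
def pos (k : {w : Pos // w ∈ N} → ℤ) (s : ℤ) (c : Cell N) : Pos :=
  sc s c.shift + (c.col, 2 * c.row k)

/-- The tile carried by a cell of the macro-tile of `t`. -/
noncomputable def tile {X : Type} (t : Tile X N) (c : Cell N) : Tile (X ⊕ Tile X N) Nvn :=
  fun d => match c with
    | ref => Sum.inr t
    | send w => if d.1 = (1, 0) then Sum.inl (t w) else Sum.inr t
    | recv w => if h : d.1 = (-1, 0) ∧ -w.1 ∈ N then Sum.inl (t ⟨-w.1, h.2⟩) else Sum.inr t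

theorem tile_ne {X : Type} {t t' : Tile X N} (h : t ≠ t') (c c' : Cell N) :
    tile t c ≠ tile t' c' := by
  intro e
  have e' := congrFun e ⟨(0, 1), by simp [Nvn]⟩
  cases c <;> cases c' <;> simp [tile] at e' <;> exact h e'

end Cell

theorem eq_and_eq_of_mul_add_eq {s a a' d d' : ℤ} (h : s * a + d = s * a' + d')
    (hd : |d - d'| < s) : a = a' ∧ d = d' := by
  have h1 : d - d' = 0 :=
    Int.eq_zero_of_abs_lt_dvd ⟨a' - a, by linear_combination h⟩ hd
  have hs : s ≠ 0 := (lt_of_le_of_lt (abs_nonneg _) hd).ne'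
  have h2 : s * a = s * a' := by linarith
  exact ⟨mul_left_cancel₀ hs h2, by linarith⟩

/-- A row numbering of the directions of `N`, fitting into squares of even side `s = 2 * m`. -/
structure RowNumbering (N : Set Pos) (k : {w : Pos // w ∈ N} → ℤ) (s m : ℤ) : Prop where
  even : s = 2 * m
  two_le : 2 ≤ m
  inj : Function.Injective k
  pos : ∀ w, 1 ≤ k w
  lt : ∀ w, k w < m

section Geometry

variable {N : Set Pos} {k : {w : Pos // w ∈ N} → ℤ} {s m : ℤ}

theorem RowNumbering.abs_row_sub_lt (hk : RowNumbering N k s m) (c c' : Cell N) :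
    |2 * c.row k - 2 * c'.row k| < s := by
  have h : ∀ c : Cell N, 0 ≤ c.row k ∧ c.row k < m := by
    have := hk.two_le
    intro c
    cases c with
    | ref => simp only [Cell.row]; omega
    | send w => have := hk.pos w; have := hk.lt w; simp only [Cell.row]; omega
    | recv w => have := hk.pos w; have := hk.lt w; simp only [Cell.row]; omega
  have := h c
  have := h c'
  have := hk.even
  rw [abs_lt]
  omega

theorem Cell.col_bounds (c : Cell N) : 0 ≤ c.col ∧ c.col ≤ 1 := by
  cases c <;> simp [Cell.col]

theorem Cell.sc_add_pos (u : Pos) (c : Cell N) :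
    sc s u + c.pos k s =
      (s * (u.1 + c.shift.1) + c.col, s * (u.2 + c.shift.2) + 2 * c.row k) := by
  ext <;> simp [Cell.pos, sc] <;> ring

theorem Cell.eq_of_sc_add_pos_eq (hk : RowNumbering N k s m) {u u' : Pos} {c c' : Cell N}
    (h : sc s u + c.pos k s = sc s u' + c'.pos k s) : u = u' ∧ c = c' := by
  rw [Cell.sc_add_pos, Cell.sc_add_pos, Prod.mk.injEq] at h
  have hs := hk.even
  have hm := hk.two_le
  obtain ⟨hx, hcol⟩ := eq_and_eq_of_mul_add_eq h.1 (by
    have := c.col_bounds; have := c'.col_bounds; rw [abs_lt]; omega)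
  obtain ⟨hy, hrow⟩ := eq_and_eq_of_mul_add_eq h.2 (hk.abs_row_sub_lt c c')
  have hc : c = c' := by
    cases c with
    | ref =>
      cases c' with
      | ref => rfl
      | send w => have := hk.pos w; simp only [Cell.row] at hrow; omega
      | recv w => simp [Cell.col] at hcol
    | send w =>
      cases c' with
      | ref => have := hk.pos w; simp only [Cell.row] at hrow; omega
      | send w' => rw [hk.inj (a₁ := w) (a₂ := w') (by simp only [Cell.row] at hrow; omega)]
      | recv w' => simp [Cell.col] at hcol
    | recv w =>
      cases c' with
      | ref => simp [Cell.col] at hcol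
      | send w' => simp [Cell.col] at hcol
      | recv w' => rw [hk.inj (a₁ := w) (a₂ := w') (by simp only [Cell.row] at hrow; omega)]
  subst hc
  exact ⟨Prod.ext (by linarith) (by linarith), rfl⟩

theorem Cell.pos_injective (hk : RowNumbering N k s m) :
    Function.Injective (Cell.pos k s) := fun c c' h =>
  (Cell.eq_of_sc_add_pos_eq hk (u := 0) (u' := 0) (by rw [h])).2

theorem Cell.sc_add_pos_recv (u : Pos) (w : {w : Pos // w ∈ N}) :
    sc s (u + w.1) + (Cell.recv w).pos k s = sc s u + (Cell.send w).pos k s + (1, 0) := by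
  ext <;> simp [Cell.pos, Cell.shift, Cell.col, Cell.row, sc] <;> ring

/-- Two horizontally adjacent cells are a sender and the matching receiver. -/
theorem Cell.send_recv_of_sub_eq (hk : RowNumbering N k s m) {u u' : Pos} {c c' : Cell N}
    (h : (sc s u' + c'.pos k s) - (sc s u + c.pos k s) = (1, 0)) :
    ∃ w : {w : Pos // w ∈ N}, c = Cell.send w ∧ c' = Cell.recv w ∧ u' = u + w.1 := by
  have hcol : c.col = 0 ∧ c'.col = 1 := by
    rw [Cell.sc_add_pos, Cell.sc_add_pos, Prod.mk_sub_mk, Prod.mk.injEq] at h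
    have := c.col_bounds
    have := c'.col_bounds
    have hs := hk.even
    have hm := hk.two_le
    have := (eq_and_eq_of_mul_add_eq (s := s) (a := u'.1 + c'.shift.1) (d := c'.col)
      (a' := u.1 + c.shift.1) (d' := c.col + 1) (by linarith [h.1])
      (by rw [abs_lt]; omega)).2
    omega
  cases c' with
  | ref => simp [Cell.col] at hcol
  | send w => simp [Cell.col] at hcol
  | recv w =>
    have h' : sc s (u' - w.1) + (Cell.send w).pos k s = sc s u + c.pos k s := by
      have e := Cell.sc_add_pos_recv (k := k) (s := s) (u' - w.1) w
      rw [sub_add_cancel] at e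
      rw [e] at h
      have := congrArg (fun p => p + (sc s u + c.pos k s) - (1, 0)) h
      simpa [sub_eq_iff_eq_add, add_comm] using this
    obtain ⟨hu, hc⟩ := Cell.eq_of_sc_add_pos_eq hk h'
    exact ⟨w, hc.symm, rfl, sub_eq_iff_eq_add.1 hu⟩

theorem Cell.adjacent (hk : RowNumbering N k s m) {u u' : Pos} {c c' : Cell N}
    (h : (sc s u' + c'.pos k s) - (sc s u + c.pos k s) ∈ Nvn) :
    (sc s u' + c'.pos k s) - (sc s u + c.pos k s) = (1, 0) ∨
      (sc s u' + c'.pos k s) - (sc s u + c.pos k s) = (-1, 0) := by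
  have hs := hk.even
  have hpar : ∃ z : ℤ, ((sc s u' + c'.pos k s) - (sc s u + c.pos k s)).2 = 2 * z :=
    ⟨m * (u'.2 + c'.shift.2) + c'.row k - (m * (u.2 + c.shift.2) + c.row k), by
      rw [Cell.sc_add_pos, Cell.sc_add_pos, hs]; simp only [Prod.snd_sub]; ring⟩
  obtain ⟨z, hz⟩ := hpar
  rcases h with h | h | h | h
  · rw [h] at hz; simp only at hz; omega
  · exact Or.inl h
  · rw [h] at hz; simp only at hz; omega
  · exact Or.inr h

end Geometry

section Simulation

variable {X : Type} {N : Set Pos} {k : {w : Pos // w ∈ N} → ℤ} {s m : ℤ}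

/-- The macro-tile simulating `t`. -/
noncomputable def macroTile (k : {w : Pos // w ∈ N} → ℤ) (s : ℤ) (t : Tile X N) :
    Pos → Option (Tile (X ⊕ Tile X N) Nvn) := fun p =>
  if h : ∃ c : Cell N, c.pos k s = p then some (h.choose.tile t) else none

theorem macroTile_eq_some_iff (hk : RowNumbering N k s m) {t : Tile X N} {p : Pos}
    {a : Tile (X ⊕ Tile X N) Nvn} :
    macroTile k s t p = some a ↔ ∃ c : Cell N, c.pos k s = p ∧ a = c.tile t := by
  unfold macroTile
  split_ifs with h
  · constructor
    · intro e
      exact ⟨h.choose, h.choose_spec, (Option.some.inj e).symm⟩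
    · rintro ⟨c, hc, rfl⟩
      rw [Cell.pos_injective hk (h.choose_spec.trans hc.symm)]
  · simp only [false_iff]
    rintro ⟨c, hc, -⟩
    exact h ⟨c, hc⟩

theorem macroTile_pos (hk : RowNumbering N k s m) (t : Tile X N) (c : Cell N) :
    macroTile k s t (c.pos k s) = some (c.tile t) :=
  (macroTile_eq_some_iff hk).2 ⟨c, rfl, rfl⟩

theorem tdom_macroTile_subset (k : {w : Pos // w ∈ N} → ℤ) (s : ℤ) (t : Tile X N) :
    tdom (macroTile k s t) ⊆ Set.range (Cell.pos k s) := by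
  intro p hp
  by_contra hc
  exact hp (dif_neg hc)

theorem Cell.finite (hN : N.Finite) : Finite (Cell N) := by
  have := hN.to_subtype
  refine Finite.of_injective
    (fun c : Cell N => (match c with
      | .ref => none
      | .send w => some (Sum.inl w)
      | .recv w => some (Sum.inr w) :
      Option ({w : Pos // w ∈ N} ⊕ {w : Pos // w ∈ N}))) ?_
  intro c c' h
  cases c <;> cases c' <;> simp_all

theorem Cell.tile_send_recv_match {t t' : Tile X N} {w : {w : Pos // w ∈ N}}
    (hw : -w.1 ∈ N) (h : (1, 0) ∈ Nvn) (h' : (-1, 0) ∈ Nvn) :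
    (Cell.send w).tile t ⟨(1, 0), h⟩ = (Cell.recv w).tile t' ⟨(-1, 0), h'⟩ ↔
      t w = t' ⟨-w.1, hw⟩ := by
  simp [Cell.tile, hw]

theorem Cell.tile_match (hsymm : ∀ w ∈ N, -w ∈ N) (hk : RowNumbering N k s m)
    {t t' : Tile X N} {u u' : Pos}
    (hmatch : ∀ w w' : {w : Pos // w ∈ N}, u' = u + w.1 → w'.1 = -w.1 → t w = t' w')
    {c c' : Cell N} {d : Pos} (hd : (sc s u' + c'.pos k s) - (sc s u + c.pos k s) = d)
    (h : d ∈ Nvn) (h' : -d ∈ Nvn) : c.tile t ⟨d, h⟩ = c'.tile t' ⟨-d, h'⟩ := by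
  rcases Cell.adjacent hk (hd ▸ h) with e | e
  · obtain ⟨w, rfl, rfl, hu⟩ := Cell.send_recv_of_sub_eq hk e
    obtain rfl : d = (1, 0) := hd.symm.trans e
    exact (Cell.tile_send_recv_match (hsymm _ w.2) h h').2 (hmatch _ _ hu rfl)
  · obtain ⟨w, rfl, rfl, hu⟩ := Cell.send_recv_of_sub_eq hk
      (u := u') (u' := u) (c := c') (c' := c) (by rw [← neg_sub, e]; rfl)
    obtain rfl : d = (-1, 0) := hd.symm.trans e
    refine ((Cell.tile_send_recv_match (hsymm _ w.2) h' h).2 ?_).symm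
    exact (hmatch ⟨-w.1, hsymm _ w.2⟩ w (by rw [hu]; simp) (by simp)).symm

theorem isFiniteTiling_macroTile (hN : IsNeighborhood N) (hk : RowNumbering N k s m)
    (t : Tile X N) : IsFiniteTiling Set.univ (macroTile k s t) := by
  have := Cell.finite hN.1
  refine ⟨⟨fun _ _ _ => Set.mem_univ _, ?_⟩,
    (Set.finite_range _).subset (tdom_macroTile_subset k s t)⟩
  intro p a ha w b hb hw hw'
  obtain ⟨c, hc, rfl⟩ := (macroTile_eq_some_iff hk).1 ha
  obtain ⟨c', hc', rfl⟩ := (macroTile_eq_some_iff hk).1 hb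
  refine Cell.tile_match hN.2.2 hk (u := 0) (u' := 0) ?_ ?_ hw hw'
  · intro v _ hv
    have hv0 : v.1 = (0, 0) := (by simpa using hv.symm : v.1 = 0)
    exact absurd (hv0 ▸ v.2) hN.2.1
  · rw [hc, hc']; simp

/-- The poly-tiling replacing every tile by its macro-tile. -/
noncomputable def macroTiling (k : {w : Pos // w ∈ N} → ℤ) (s : ℤ)
    (τ : Pos → Option (Tile X N)) : Pos → Option (Pos → Option (Tile (X ⊕ Tile X N) Nvn)) :=
  fun u => (τ u).map (macroTile k s)

theorem macroTile_injective (hk : RowNumbering N k s m) :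
    Function.Injective (macroTile (X := X) k s) := by
  intro t t' h
  by_contra hne
  have e := congrFun h (Cell.ref.pos k s)
  rw [macroTile_pos hk, macroTile_pos hk] at e
  exact Cell.tile_ne hne _ _ (Option.some.inj e)

theorem macroTiling_injective (hk : RowNumbering N k s m) :
    Function.Injective (macroTiling (X := X) k s) := fun _ _ h =>
  funext fun u => Option.map_injective (macroTile_injective hk) (congrFun h u)

theorem macroTiling_eq_some_iff {τ : Pos → Option (Tile X N)} {u : Pos}
    {σu : Pos → Option (Tile (X ⊕ Tile X N) Nvn)} :
    macroTiling k s τ u = some σu ↔ ∃ t, τ u = some t ∧ macroTile k s t = σu := by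
  simp [macroTiling]

theorem isPolyTiling_macroTiling (hN : IsNeighborhood N) (hk : RowNumbering N k s m)
    {T : Set (Tile X N)} {τ : Pos → Option (Tile X N)} (hτ : IsTiling T τ) :
    IsPolyTiling Set.univ s (macroTiling k s τ) := by
  refine ⟨?_, ?_, ?_⟩
  · intro u σu h
    obtain ⟨t, -, rfl⟩ := macroTiling_eq_some_iff.1 h
    exact isFiniteTiling_macroTile hN hk t
  · intro u v σu σv huv hu hv p hp q hq e
    obtain ⟨t, -, rfl⟩ := macroTiling_eq_some_iff.1 hu
    obtain ⟨t', -, rfl⟩ := macroTiling_eq_some_iff.1 hv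
    obtain ⟨c, rfl⟩ := tdom_macroTile_subset k s t hp
    obtain ⟨c', rfl⟩ := tdom_macroTile_subset k s t' hq
    exact huv (Cell.eq_of_sc_add_pos_eq hk e).1
  · intro u u' σu σu' hu hu' v a ha v' a' ha' hw hw'
    obtain ⟨t, ht, rfl⟩ := macroTiling_eq_some_iff.1 hu
    obtain ⟨t', ht', rfl⟩ := macroTiling_eq_some_iff.1 hu'
    obtain ⟨c, rfl, rfl⟩ := (macroTile_eq_some_iff hk).1 ha
    obtain ⟨c', rfl, rfl⟩ := (macroTile_eq_some_iff hk).1 ha'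
    refine Cell.tile_match hN.2.2 hk ?_ rfl hw hw'
    rintro w ⟨_, hw''⟩ rfl rfl
    exact hτ.2 u t ht w.1 t' ht' w.2 hw''

/-- The macro-tile of `t` occurs in `τ'` at grid position `u`. -/
def Occurs (k : {w : Pos // w ∈ N} → ℤ) (s : ℤ)
    (τ' : Pos → Option (Tile (X ⊕ Tile X N) Nvn)) (u : Pos) (t : Tile X N) : Prop :=
  ∀ p a, macroTile k s t p = some a → τ' (sc s u + p) = some a

theorem Occurs.cell (hk : RowNumbering N k s m)
    {τ' : Pos → Option (Tile (X ⊕ Tile X N) Nvn)} {u : Pos} {t : Tile X N}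
    (h : Occurs k s τ' u t) (c : Cell N) : τ' (sc s u + c.pos k s) = some (c.tile t) :=
  h _ _ (macroTile_pos hk t c)

/-- The tiling simulated by `τ'`. -/
noncomputable def simulated (T : Set (Tile X N)) (k : {w : Pos // w ∈ N} → ℤ) (s : ℤ)
    (τ' : Pos → Option (Tile (X ⊕ Tile X N) Nvn)) : Pos → Option (Tile X N) := fun u =>
  if h : ∃ t ∈ T, Occurs k s τ' u t then some h.choose else none

theorem simulated_spec {T : Set (Tile X N)} {τ' : Pos → Option (Tile (X ⊕ Tile X N) Nvn)}
    {u : Pos} {t : Tile X N} (h : simulated T k s τ' u = some t) :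
    t ∈ T ∧ Occurs k s τ' u t := by
  unfold simulated at h
  split_ifs at h with h'
  cases h
  exact h'.choose_spec

theorem simulated_ne_none {T : Set (Tile X N)} {τ' : Pos → Option (Tile (X ⊕ Tile X N) Nvn)}
    {u : Pos} {t : Tile X N} (ht : t ∈ T) (h : Occurs k s τ' u t) :
    simulated T k s τ' u ≠ none := by
  have h' : ∃ t ∈ T, Occurs k s τ' u t := ⟨t, ht, h⟩
  simp [simulated, h']

theorem isTiling_simulated (hk : RowNumbering N k s m) {T : Set (Tile X N)}
    {τ' : Pos → Option (Tile (X ⊕ Tile X N) Nvn)} (hτ' : IsTiling Set.univ τ') :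
    IsTiling T (simulated T k s τ') := by
  refine ⟨fun _ _ h => (simulated_spec h).1, ?_⟩
  intro u t ht w t' ht' hw hw'
  have hs := (simulated_spec ht).2.cell hk (Cell.send ⟨w, hw⟩)
  have hr := (simulated_spec ht').2.cell hk (Cell.recv ⟨w, hw⟩)
  rw [Cell.sc_add_pos_recv u ⟨w, hw⟩] at hr
  exact (Cell.tile_send_recv_match (w := ⟨w, hw⟩) hw' _ _).1
    (hτ'.2 _ _ hs _ _ hr (by simp [Nvn]) (by simp [Nvn]))

/-- The simulation of `T` by macro-tiles. -/
noncomputable def macroSimulation (hN : IsNeighborhood N) (hk : RowNumbering N k s m)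
    (T : Set (Tile X N)) : TilingSimulation X (X ⊕ Tile X N) N T Set.univ s where
  hs := by have := hk.even; have := hk.two_le; omega
  phi t := {macroTile k s t}
  phi_fin := by
    rintro t _ rfl
    exact isFiniteTiling_macroTile hN hk t
  phi_ref := by
    rintro t _ rfl
    have h : (Cell.ref : Cell N).pos k s = (0, 0) := by
      simp [Cell.pos, Cell.shift, Cell.col, Cell.row, sc]
    rw [← h, macroTile_pos hk]
    simp
  phi_spec := by
    rintro t t' htt' _ rfl _ rfl p q a b ha hb
    obtain ⟨c, -, rfl⟩ := (macroTile_eq_some_iff hk).1 ha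
    obtain ⟨c', -, rfl⟩ := (macroTile_eq_some_iff hk).1 hb
    exact Cell.tile_ne htt' c c'
  chi τ' := macroTiling k s (simulated T k s τ')
  chi_poly τ' hτ' := isPolyTiling_macroTiling hN hk (isTiling_simulated (T := T) hk hτ')
  chi_sub := by
    intro τ' u σu h
    obtain ⟨t, ht, rfl⟩ := macroTiling_eq_some_iff.1 h
    exact ⟨⟨t, (simulated_spec ht).1, rfl⟩, (simulated_spec ht).2⟩
  chi_max := by
    rintro τ' t ht _ rfl u h
    simpa [macroTiling] using simulated_ne_none ht h
  psi τ := {macroTiling k s τ}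
  psi_nonempty _ _ := Set.singleton_nonempty _
  psi_poly := by
    rintro τ hτ _ rfl
    exact isPolyTiling_macroTiling hN hk hτ
  psi_dom := by
    rintro τ - _ rfl u
    simp [macroTiling]
  psi_comp := by
    rintro τ - _ rfl u t ht σu h
    obtain ⟨t', ht', rfl⟩ := macroTiling_eq_some_iff.1 h
    rw [Option.some.inj (ht'.symm.trans ht)]
    rfl
  psi_recover τ' hτ' :=
    ⟨simulated T k s τ', ⟨isTiling_simulated hk hτ', rfl⟩,
      fun _ h => (macroTiling_injective hk h.2).symm⟩

theorem tdom_induced_macroTiling (hk : RowNumbering N k s m) (τ : Pos → Option (Tile X N)) :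
    tdom (induced s (macroTiling k s τ)) =
      Set.image2 (fun u (c : Cell N) => sc s u + c.pos k s) (tdom τ) Set.univ := by
  ext p
  have h1 : p ∈ tdom (induced s (macroTiling k s τ)) ↔
      ∃ a, ∃ u σu v, macroTiling k s τ u = some σu ∧ σu v = some a ∧ p = sc s u + v := by
    simp only [tdom, induced, Set.mem_ofPred_eq]
    split_ifs with h
    · simpa using h
    · simpa using h
  rw [h1]
  constructor
  · rintro ⟨a, u, σu, v, hu, hv, rfl⟩
    obtain ⟨t, ht, rfl⟩ := macroTiling_eq_some_iff.1 hu
    obtain ⟨c, rfl, -⟩ := (macroTile_eq_some_iff hk).1 hv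
    exact ⟨u, by simp [tdom, ht], c, Set.mem_univ _, rfl⟩
  · rintro ⟨u, hu, c, -, rfl⟩
    obtain ⟨t, ht⟩ := Option.ne_none_iff_exists'.1 hu
    exact ⟨_, u, _, _, macroTiling_eq_some_iff.2 ⟨t, ht, rfl⟩, macroTile_pos hk t c, rfl⟩

theorem finite_tdom_induced_macroTiling_iff (hN : IsNeighborhood N)
    (hk : RowNumbering N k s m) (τ : Pos → Option (Tile X N)) :
    (tdom (induced s (macroTiling k s τ))).Finite ↔ (tdom τ).Finite := by
  have := Cell.finite hN.1
  rw [tdom_induced_macroTiling hk]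
  constructor
  · intro h
    have hinj : Function.Injective fun u => sc s u + (Cell.ref : Cell N).pos k s :=
      fun _ _ e => (Cell.eq_of_sc_add_pos_eq hk e).1
    refine Set.Finite.of_finite_image (h.subset ?_) hinj.injOn
    rintro _ ⟨u, hu, rfl⟩
    exact ⟨u, hu, Cell.ref, Set.mem_univ _, rfl⟩
  · intro h
    exact h.image2 _ Set.finite_univ

end Simulation

theorem exists_rowNumbering {N : Set Pos} (hN : N.Finite) :
    ∃ k s m, RowNumbering N k s m := by
  have := hN.to_subtype
  obtain ⟨n, ⟨e⟩⟩ := Finite.exists_equiv_fin {w : Pos // w ∈ N}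
  refine ⟨fun w => (e w : ℕ) + 1, 2 * (n + 2), n + 2, rfl, by omega, ?_, ?_, ?_⟩
  · intro w w' h
    exact e.injective (Fin.ext (by simpa using h))
  · intro w
    omega
  · intro w
    have := (e w).2
    omega

/-- a tiling-simulation preserving finiteness: a tiling is finite
iff every poly-tiling in its image, viewed via its induced tiling, is finite. -/
theorem stmt17 (X : Type) [Fintype X] (N : Set Pos) (hN : IsNeighborhood N)
    (T : Set (Tile X N)) (hT : T.Finite) :
    ∃ (Xμ : Type) (_ : Fintype Xμ) (Tμ : Set (Tile Xμ Nvn)) (_ : Tμ.Finite)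
      (s : ℤ) (sim : TilingSimulation X Xμ N T Tμ s),
      ∀ τ, IsTiling T τ →
        ((tdom τ).Finite ↔ ∀ σ ∈ sim.psi τ, (tdom (induced s σ)).Finite) := by
  have := hN.1.to_subtype
  have hfin : Finite {w : Pos // w ∈ Nvn} := Set.Finite.to_subtype (by simp [Nvn])
  obtain ⟨k, s, m, hk⟩ := exists_rowNumbering hN.1
  refine ⟨X ⊕ Tile X N, Fintype.ofFinite _, Set.univ, Set.toFinite _, s,
    macroSimulation hN hk T, fun τ _ => ?_⟩
  rw [← finite_tdom_induced_macroTiling_iff hN hk τ]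
  exact ⟨fun h _ hσ => hσ ▸ h, fun h => h _ rfl⟩

end Paper
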